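/- Assume a graph G satisfies: (i) volume growth |B_x(r)| ≍ r^α, (ii) expected exit time bounds E_y[τ_r(x)] ≤ C r^β for all y ∈ B_x(r), and (iii) the Green function lower bound inf_{y ∈ B_x(ur)} g_r(x,y) ≥ c(u) r^{β−α} for each u ∈ (0,1). Then for every ε > 0 there exists η > 0 such that for all x, all sufficiently large r, and all A ⊂ B_x(r) with |A| ≥ ε |B_x(r)|, the walk started at x hits A before exiting B_x(r) with probability at least η. -/

import Mathlib

open Finset

attribute [local instance] Classical.propDecidable

namespace IDLA

variable {V : Type*}

/-- The weight (probability) of a given path of the simple random walk. -/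
noncomputable def pathWeight (G : SimpleGraph V) [G.LocallyFinite] {n : ℕ}
    (p : Fin (n + 1) → V) : ℝ :=
  ∏ i : Fin n, ((G.degree (p i.castSucc) : ℝ))⁻¹

/-- A path is a nearest-neighbor walk staying inside `B`. -/
def IsWalkIn (G : SimpleGraph V) (B : Set V) {n : ℕ} (p : Fin (n + 1) → V) : Prop :=
  (∀ i : Fin n, G.Adj (p i.castSucc) (p i.succ)) ∧ ∀ i, p i ∈ B

/-- Stopped Green function `g_B(y,x)`: expected number of visits to `x` of the simple
random walk started at `y`, before exiting `B`. -/
noncomputable def green (G : SimpleGraph V) [G.LocallyFinite] (B : Set V) (y x : V) : ℝ :=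
  ∑' n : ℕ, ∑' p : Fin (n + 1) → V,
    if IsWalkIn G B p ∧ p 0 = y ∧ p (Fin.last n) = x then pathWeight G p else 0

/-- `P_y[τ_x < τ_B]`: probability that the walk started at `y` hits `x` before exiting `B`. -/
noncomputable def hitProb (G : SimpleGraph V) [G.LocallyFinite] (B : Set V) (y x : V) : ℝ :=
  ∑' n : ℕ, ∑' p : Fin (n + 1) → V,
    if IsWalkIn G B p ∧ p 0 = y ∧ p (Fin.last n) = x ∧ (∀ i : Fin n, p i.castSucc ≠ x)
    then pathWeight G p else 0

/-- `P_y[σ_A < τ_B]`: probability that the walk started at `y` hits the set `A`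
before exiting `B`. -/
noncomputable def hitSetProb (G : SimpleGraph V) [G.LocallyFinite] (B A : Set V) (y : V) : ℝ :=
  ∑' n : ℕ, ∑' p : Fin (n + 1) → V,
    if IsWalkIn G B p ∧ p 0 = y ∧ p (Fin.last n) ∈ A ∧ (∀ i : Fin n, p i.castSucc ∉ A)
    then pathWeight G p else 0

/-- Expected exit time `E_y[τ_B] = ∑_{n ≥ 0} P_y[τ_B > n]`. -/
noncomputable def expectedExitTime (G : SimpleGraph V) [G.LocallyFinite] (B : Set V) (y : V) : ℝ :=
  ∑' n : ℕ, ∑' p : Fin (n + 1) → V,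
    if IsWalkIn G B p ∧ p 0 = y then pathWeight G p else 0

/-- Open ball of real radius `r` about `o` in the graph metric. -/
def ball (G : SimpleGraph V) (o : V) (r : ℝ) : Set V := {y | (G.dist o y : ℝ) < r}

/-- Probabilistic graph Laplacian. -/
noncomputable def lap (G : SimpleGraph V) [G.LocallyFinite] (h : V → ℝ) (z : V) : ℝ :=
  (∑ y ∈ G.neighborFinset z, h y) / (G.degree z) - h z

/-- First-step recursion for the walk killed outside `B`, avoiding `D`, ending in `E`. -/
noncomputable def recS (G : SimpleGraph V) [G.LocallyFinite] (B D E : Set V) : ℕ → V → ℝ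
  | 0, y => if y ∈ B ∧ y ∈ E then 1 else 0
  | n + 1, y => if y ∈ B ∧ y ∉ D then
      ∑ z ∈ G.neighborFinset y, ((G.degree y : ℝ))⁻¹ * recS G B D E n z else 0

/-- The path summand. -/
noncomputable def pathT (G : SimpleGraph V) [G.LocallyFinite] (B D E : Set V) (n : ℕ) (y : V)
    (p : Fin (n + 1) → V) : ℝ :=
  if IsWalkIn G B p ∧ p 0 = y ∧ p (Fin.last n) ∈ E ∧ (∀ i : Fin n, p i.castSucc ∉ D)
    then pathWeight G p else 0

theorem isWalkIn_cons (G : SimpleGraph V) (B : Set V) {n : ℕ} (a : V) (q : Fin (n + 1) → V) :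
    IsWalkIn G B (Fin.cons a q : Fin (n + 2) → V) ↔ a ∈ B ∧ G.Adj a (q 0) ∧ IsWalkIn G B q := by
  unfold IsWalkIn
  rw [Fin.forall_fin_succ, Fin.forall_fin_succ (P := fun i => (Fin.cons a q : Fin (n + 2) → V) i ∈ B)]
  simp only [Fin.castSucc_zero, Fin.cons_zero, Fin.cons_succ, ← Fin.succ_castSucc]
  tauto

theorem pathWeight_cons (G : SimpleGraph V) [G.LocallyFinite] {n : ℕ} (a : V)
    (q : Fin (n + 1) → V) :
    pathWeight G (Fin.cons a q : Fin (n + 2) → V) = ((G.degree a : ℝ))⁻¹ * pathWeight G q := by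
  unfold pathWeight
  rw [Fin.prod_univ_succ]
  rfl

theorem pathT_cons (G : SimpleGraph V) [G.LocallyFinite] (B D E : Set V) (n : ℕ) (y : V)
    (q : Fin (n + 1) → V) :
    pathT G B D E (n + 1) y (Fin.cons y q) = if y ∈ B ∧ y ∉ D then
      ∑ z ∈ G.neighborFinset y, ((G.degree y : ℝ))⁻¹ * pathT G B D E n z q else 0 := by
  have hD : (∀ i : Fin (n + 1), (Fin.cons y q : Fin (n + 2) → V) i.castSucc ∉ D) ↔
      y ∉ D ∧ ∀ i : Fin n, q i.castSucc ∉ D := by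
    rw [Fin.forall_fin_succ]
    simp only [Fin.castSucc_zero, Fin.cons_zero, Fin.cons_succ, ← Fin.succ_castSucc]
  have hl : (Fin.cons y q : Fin (n + 2) → V) (Fin.last (n + 1)) = q (Fin.last n) := by
    rw [← Fin.succ_last, Fin.cons_succ]
  unfold pathT
  simp only [isWalkIn_cons, hD, hl, pathWeight_cons, Fin.cons_zero, true_and]
  by_cases h : y ∈ B ∧ y ∉ D
  · rw [if_pos h]
    by_cases ha : G.Adj y (q 0)
    · rw [Finset.sum_eq_single (q 0)]
      · simp only [h.1, h.2, ha, true_and, not_false_eq_true]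
        rw [mul_ite, mul_zero]
      · intro b _ hb
        rw [if_neg (fun hh => hb hh.2.1.symm), mul_zero]
      · intro hh
        exact absurd ((G.mem_neighborFinset y _).2 ha) hh
    · rw [if_neg (fun hh => ha hh.1.2.1)]
      symm
      apply Finset.sum_eq_zero
      intro z hz
      rw [if_neg, mul_zero]
      rintro ⟨_, h0, _⟩
      rw [h0] at ha
      exact ha ((G.mem_neighborFinset y _).1 hz)
  · rw [if_neg h, if_neg]
    tauto

theorem hasSum_pathT (G : SimpleGraph V) [G.LocallyFinite] (B D E : Set V) (n : ℕ) :
    ∀ y, HasSum (pathT G B D E n y) (recS G B D E n y) := by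
  induction n with
  | zero =>
    intro y
    have h := hasSum_single (f := pathT G B D E 0 y) (fun _ => y) (by
      intro p hp
      unfold pathT
      rw [if_neg]
      rintro ⟨_, h0, _⟩
      apply hp
      funext i
      have hi : i = 0 := Fin.ext (by omega)
      rw [hi, h0])
    convert h using 1
    simp [recS, pathT, IsWalkIn, pathWeight]
  | succ n ih =>
    intro y
    have hinj : Function.Injective (fun q : Fin (n + 1) → V => (Fin.cons y q : Fin (n + 2) → V)) :=
      Fin.cons_right_injective (α := fun _ => V) y
    rw [← hinj.hasSum_iff]
    · have : (pathT G B D E (n + 1) y ∘ fun q : Fin (n + 1) → V => (Fin.cons y q : Fin (n + 2) → V))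
          = fun q => if y ∈ B ∧ y ∉ D then
      ∑ z ∈ G.neighborFinset y, ((G.degree y : ℝ))⁻¹ * pathT G B D E n z q else 0 := by
        funext q
        exact pathT_cons G B D E n y q
      rw [this]
      simp only [recS]
      by_cases h : y ∈ B ∧ y ∉ D
      · simp only [if_pos h]
        exact hasSum_sum (fun z _ => (ih z).mul_left _)
      · simp only [if_neg h]
        exact hasSum_zero
    · intro p hp
      unfold pathT
      rw [if_neg]
      rintro ⟨_, h0, _⟩
      apply hp
      exact ⟨Fin.tail p, by rw [← h0]; exact Fin.cons_self_tail p⟩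

theorem green_eq (G : SimpleGraph V) [G.LocallyFinite] (B : Set V) (y x : V) :
    green G B y x = ∑' n, recS G B ∅ {x} n y := by
  unfold green
  refine tsum_congr fun n => ?_
  rw [← (hasSum_pathT G B ∅ {x} n y).tsum_eq]
  refine tsum_congr fun p => ?_
  simp [pathT]

theorem hitSetProb_eq (G : SimpleGraph V) [G.LocallyFinite] (B A : Set V) (y : V) :
    hitSetProb G B A y = ∑' n, recS G B A A n y := by
  unfold hitSetProb
  refine tsum_congr fun n => ?_
  rw [← (hasSum_pathT G B A A n y).tsum_eq]
  rfl

theorem exit_eq (G : SimpleGraph V) [G.LocallyFinite] (B : Set V) (y : V) :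
    expectedExitTime G B y = ∑' n, recS G B ∅ Set.univ n y := by
  unfold expectedExitTime
  refine tsum_congr fun n => ?_
  rw [← (hasSum_pathT G B ∅ Set.univ n y).tsum_eq]
  refine tsum_congr fun p => ?_
  simp [pathT]

theorem recS_nonneg (G : SimpleGraph V) [G.LocallyFinite] (B D E : Set V) (n : ℕ) :
    ∀ y, 0 ≤ recS G B D E n y := by
  induction n with
  | zero => intro y; simp only [recS]; split_ifs <;> norm_num
  | succ n ih =>
    intro y; simp only [recS]; split_ifs
    · exact Finset.sum_nonneg fun z _ => mul_nonneg (by positivity) (ih z)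
    · exact le_rfl

theorem recS_le (G : SimpleGraph V) [G.LocallyFinite] (B D E : Set V) (n : ℕ) :
    ∀ y, recS G B D E n y ≤ recS G B ∅ Set.univ n y := by
  induction n with
  | zero =>
    intro y; simp only [recS, Set.mem_univ, and_true]
    split_ifs <;> first | tauto | norm_num
  | succ n ih =>
    intro y; simp only [recS, Set.mem_empty_iff_false, not_false_eq_true, and_true]
    by_cases h : y ∈ B
    · rw [if_pos h]
      split_ifs
      · exact Finset.sum_le_sum fun z _ => mul_le_mul_of_nonneg_left (ih z) (by positivity)
      · exact Finset.sum_nonneg fun z _ => mul_nonneg (by positivity) (recS_nonneg ..)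
    · rw [if_neg h, if_neg (fun hh => h hh.1)]

theorem sum_recS (G : SimpleGraph V) [G.LocallyFinite] (B D : Set V) (F : Finset V) (n : ℕ) :
    ∀ y, ∑ a ∈ F, recS G B D {a} n y = recS G B D (F : Set V) n y := by
  induction n with
  | zero =>
    intro y; simp only [recS, Set.mem_singleton_iff, Finset.mem_coe]
    by_cases h : y ∈ B <;> simp [h]
  | succ n ih =>
    intro y; simp only [recS]
    by_cases h : y ∈ B ∧ y ∉ D
    · simp only [if_pos h]
      rw [Finset.sum_comm]
      refine Finset.sum_congr rfl fun z _ => ?_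
      rw [← Finset.mul_sum, ih]
    · simp [if_neg h]

/-- A killed walk in `B` always ends in `B`. -/
theorem recS_univ (G : SimpleGraph V) [G.LocallyFinite] (B D : Set V) (n : ℕ) :
    ∀ y, recS G B D Set.univ n y = recS G B D B n y := by
  induction n with
  | zero => intro y; simp [recS]
  | succ n ih => intro y; simp only [recS, ih]

/-- Key potential-theoretic inequality. -/
theorem key_ineq (G : SimpleGraph V) [G.LocallyFinite] (B A A' : Set V) (hA : A ⊆ B)
    (hA' : A' ⊆ A) (M : ℝ)
    (hM : ∀ z ∈ A, ∀ N, ∑ n ∈ Finset.range N, recS G B ∅ A' n z ≤ M) (N : ℕ) :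
    ∀ y, ∑ n ∈ Finset.range N, recS G B ∅ A' n y ≤
      M * ∑ n ∈ Finset.range N, recS G B A A n y := by
  induction N with
  | zero => intro y; simp
  | succ N ih =>
    intro y
    by_cases hy : y ∈ A
    · refine (hM y hy _).trans ?_
      have h0 : 0 ≤ M := by simpa using hM y hy 0
      have : (1 : ℝ) ≤ ∑ n ∈ Finset.range (N + 1), recS G B A A n y := by
        rw [Finset.sum_range_succ']
        have h1 : recS G B A A 0 y = 1 := by simp [recS, hy, hA hy]
        have := Finset.sum_nonneg (s := Finset.range N)
          (fun n _ => recS_nonneg G B A A (n + 1) y)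
        linarith
      nlinarith
    · rw [Finset.sum_range_succ', Finset.sum_range_succ']
      have h1 : recS G B ∅ A' 0 y = 0 := by
        simp only [recS]; rw [if_neg]; exact fun h => hy (hA' h.2)
      have h2 : recS G B A A 0 y = 0 := by
        simp only [recS]; rw [if_neg]; exact fun h => hy h.2
      rw [h1, h2, add_zero, add_zero]
      simp only [recS]
      by_cases hB : y ∈ B
      · simp only [hB, hy, Set.mem_empty_iff_false, not_false_eq_true, and_true, if_true]
        rw [Finset.sum_comm, Finset.sum_comm (s := Finset.range N), Finset.mul_sum]
        refine Finset.sum_le_sum fun z _ => ?_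
        rw [← Finset.mul_sum, ← Finset.mul_sum, mul_left_comm]
        exact mul_le_mul_of_nonneg_left (ih z) (by positivity)
      · simp [hB]

theorem summable_nbr (G : SimpleGraph V) [G.LocallyFinite] (B : Set V) (y z : V)
    (hy : y ∈ B) (hz : G.Adj y z) (h : Summable fun n => recS G B ∅ Set.univ n y) :
    Summable fun n => recS G B ∅ Set.univ n z := by
  have h1 := ((summable_nat_add_iff 1).2 h).mul_left (G.degree y : ℝ)
  refine Summable.of_nonneg_of_le (fun n => recS_nonneg ..) (fun n => ?_) h1
  have hd : (0 : ℝ) < G.degree y := by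
    exact_mod_cast (G.degree_pos_iff_exists_adj y).2 ⟨z, hz⟩
  simp only [recS, hy, Set.mem_empty_iff_false, not_false_eq_true, and_true, if_true]
  rw [← Finset.mul_sum, mul_inv_cancel_left₀ hd.ne']
  exact Finset.single_le_sum (f := fun z => recS G B ∅ Set.univ n z)
    (fun w _ => recS_nonneg ..) ((G.mem_neighborFinset y z).2 hz)

theorem exists_on_geodesic (G : SimpleGraph V) (hG : G.Preconnected) (x y : V) (m : ℕ)
    (hm : m ≤ G.dist x y) : ∃ z, G.dist x z = m ∧ G.dist z y + m = G.dist x y := by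
  obtain ⟨p, hp⟩ := (hG x y).exists_walk_length_eq_dist
  refine ⟨p.getVert m, ?_⟩
  have h1 := SimpleGraph.dist_le (p.take m)
  have h2 := SimpleGraph.dist_le (p.drop m)
  have h3 := (hG x (p.getVert m)).dist_triangle_left y
  rw [SimpleGraph.Walk.take_length] at h1
  rw [SimpleGraph.Walk.drop_length] at h2
  omega

theorem summable_ball (G : SimpleGraph V) [G.LocallyFinite] (hG : G.Preconnected) (x : V) (r : ℝ)
    (h : Summable fun n => recS G (ball G x r) ∅ Set.univ n x) (d : ℕ) :
    ∀ z ∈ ball G x r, G.dist x z = d →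
      Summable fun n => recS G (ball G x r) ∅ Set.univ n z := by
  induction d with
  | zero =>
    intro z _ hd
    have := ((hG x z).dist_eq_zero_iff).1 hd
    rwa [← this]
  | succ d ih =>
    intro z hz hd
    obtain ⟨w, hw, hw2⟩ := exists_on_geodesic G hG x z d (by omega)
    have hwb : w ∈ ball G x r := by
      have hz' : (G.dist x z : ℝ) < r := hz
      change (G.dist x w : ℝ) < r
      rw [hw]; rw [hd] at hz'; push_cast at hz'; linarith
    exact summable_nbr G _ w z hwb (SimpleGraph.dist_eq_one_iff_adj.1 (by omega)) (ih w hwb hw)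

theorem ball_finite (G : SimpleGraph V) (α C : ℝ) (hC : 1 ≤ C)
    (hvol : ∀ (x : V) (r : ℝ), 1 ≤ r →
      C⁻¹ * r ^ α ≤ ((ball G x r).ncard : ℝ) ∧ ((ball G x r).ncard : ℝ) ≤ C * r ^ α)
    (x : V) (r : ℝ) : (ball G x r).Finite := by
  have h1 : (ball G x (max r 1)).Finite := by
    apply Set.finite_of_ncard_ne_zero
    have h := (hvol x (max r 1) (le_max_right _ _)).1
    have : 0 < C⁻¹ * (max r 1) ^ α := by positivity
    intro h0
    rw [h0] at h
    simp at h
    linarith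
  exact h1.subset fun y hy => lt_of_lt_of_le (show (G.dist x y : ℝ) < r from hy) (le_max_left _ _)

theorem preconn (G : SimpleGraph V) (α C : ℝ) (hC : 1 ≤ C) (hα : 0 < α)
    (hvol : ∀ (x : V) (r : ℝ), 1 ≤ r →
      C⁻¹ * r ^ α ≤ ((ball G x r).ncard : ℝ) ∧ ((ball G x r).ncard : ℝ) ≤ C * r ^ α) :
    G.Preconnected := by
  by_contra hcon
  unfold SimpleGraph.Preconnected at hcon
  push Not at hcon
  obtain ⟨x, y, hxy⟩ := hcon
  have hfin : (Set.univ : Set V).Finite := by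
    refine ((ball_finite G α C hC hvol x 1).union (ball_finite G α C hC hvol y 1)).subset ?_
    intro z _
    by_cases hz : G.Reachable x z
    · right
      have : ¬ G.Reachable y z := fun h => hxy (hz.trans h.symm)
      simp [ball, this]
    · left
      simp [ball, hz]
  have ht := (tendsto_rpow_atTop hα).eventually_gt_atTop (C * (Set.univ : Set V).ncard)
  obtain ⟨r, hr1, hr2⟩ := (ht.and (Filter.eventually_ge_atTop (1 : ℝ))).exists
  have h := (hvol x r hr2).1
  have h2 : ((ball G x r).ncard : ℝ) ≤ (Set.univ : Set V).ncard := by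
    exact_mod_cast Set.ncard_le_ncard (Set.subset_univ _) hfin
  have h3 : r ^ α ≤ C * (ball G x r).ncard := by
    rwa [inv_mul_le_iff₀ (by linarith)] at h
  nlinarith

/-- Annulus `r - t ≤ d(x,y) < r`. -/
def ann (G : SimpleGraph V) (x : V) (r t : ℝ) : Set V :=
  {y | r - t ≤ (G.dist x y : ℝ) ∧ (G.dist x y : ℝ) < r}

theorem ann_step (G : SimpleGraph V) (α C : ℝ) (hC : 1 ≤ C) (hα : 0 < α)
    (hvol : ∀ (x : V) (r : ℝ), 1 ≤ r →
      C⁻¹ * r ^ α ≤ ((ball G x r).ncard : ℝ) ∧ ((ball G x r).ncard : ℝ) ≤ C * r ^ α)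
    (x : V) (r t : ℝ) (ht : 1 ≤ t) (htr : 4 * t ≤ r) :
    (1 + C ^ 2 * 4 ^ α) * ((ann G x r t).ncard : ℝ) ≤
      (C ^ 2 * 4 ^ α) * ((ann G x r (4 * t)).ncard : ℝ) := by
  have hG := preconn G α C hC hα hvol
  have hconn : ∀ a b c, G.dist a c ≤ G.dist a b + G.dist b c := fun a b c =>
    (hG a b).dist_triangle_left c
  have hbf := ball_finite G α C hC hvol
  have hfin : ∀ s, (ann G x r s).Finite := fun s => (hbf x r).subset fun y hy => hy.2
  have hsub : ann G x r t ⊆ ann G x r (4 * t) := fun y hy => ⟨by linarith [hy.1], hy.2⟩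
  set a := (hfin t).toFinset with ha
  set b := ((hfin (4 * t)).subset (Set.sdiff_subset (t := ann G x r t))).toFinset with hb
  have hca : (ann G x r t).ncard = a.card := Set.ncard_eq_toFinset_card _ _
  have hcb : (ann G x r (4 * t)).ncard = b.card + a.card := by
    rw [← Set.ncard_sdiff_add_ncard_of_subset hsub (hfin _), hca,
      Set.ncard_eq_toFinset_card _ ((hfin (4 * t)).subset (Set.sdiff_subset (t := ann G x r t)))]
  have hz : ∀ y ∈ ann G x r t, ∃ z, G.dist x z = ⌊r - 2 * t⌋₊ ∧
      G.dist z y + ⌊r - 2 * t⌋₊ = G.dist x y := by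
    intro y hy
    apply exists_on_geodesic G hG
    have := Nat.floor_le (show 0 ≤ r - 2 * t by linarith)
    have h1 := hy.1
    have : ((⌊r - 2 * t⌋₊ : ℕ) : ℝ) ≤ G.dist x y := by linarith
    exact_mod_cast this
  choose! f hf1 hf2 using hz
  have hm1 := Nat.floor_le (show 0 ≤ r - 2 * t by linarith)
  have hm2 := Nat.lt_floor_add_one (r - 2 * t)
  set m := ⌊r - 2 * t⌋₊ with hm
  have hdc := Finset.sum_card_bipartiteAbove_eq_sum_card_bipartiteBelow
    (s := a) (t := b) (fun y w => w ∈ ball G (f y) t)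
  have hlow : ∀ y ∈ a, C⁻¹ * t ^ α ≤
      ((Finset.bipartiteAbove (fun y w => w ∈ ball G (f y) t) b y).card : ℝ) := by
    intro y hy
    have hy : y ∈ ann G x r t := by simpa [ha] using hy
    refine (hvol (f y) t ht).1.trans ?_
    rw [← Set.ncard_coe_finset]
    refine Nat.cast_le.2 ?_
    refine Set.ncard_le_ncard ?_ (Finset.finite_toSet _)
    intro w hw
    have hw' : (G.dist (f y) w : ℝ) < t := hw
    have e1 := hf1 y hy
    have h1 : (G.dist x w : ℝ) ≤ m + G.dist (f y) w := by
      rw [← e1]; exact_mod_cast hconn x (f y) w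
    have h2 : (m : ℝ) ≤ G.dist x w + G.dist (f y) w := by
      rw [← e1, SimpleGraph.dist_comm (u := f y)]; exact_mod_cast hconn x w (f y)
    simp only [Finset.coe_bipartiteAbove, Set.mem_setOf_eq, hb, Set.Finite.mem_toFinset,
      Set.mem_sdiff, ann]
    refine ⟨⟨⟨by linarith, by linarith⟩, fun hh => by linarith [hh.1]⟩, hw⟩
  have hup : ∀ w ∈ b,
      ((Finset.bipartiteBelow (fun y w => w ∈ ball G (f y) t) a w).card : ℝ) ≤
        C * (4 * t) ^ α := by
    intro w _
    refine le_trans ?_ (hvol w (4 * t) (by linarith)).2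
    rw [← Set.ncard_coe_finset]
    refine Nat.cast_le.2 ?_
    refine Set.ncard_le_ncard ?_ (hbf _ _)
    intro y hy
    simp only [Finset.coe_bipartiteBelow, Set.mem_setOf_eq, ha, Set.Finite.mem_toFinset] at hy
    obtain ⟨hy, hw⟩ := hy
    have hw' : (G.dist (f y) w : ℝ) < t := hw
    have e2 : (G.dist (f y) y : ℝ) + m = G.dist x y := by exact_mod_cast hf2 y hy
    have h1 : (G.dist w y : ℝ) ≤ G.dist (f y) w + G.dist (f y) y := by
      rw [SimpleGraph.dist_comm (u := f y) (v := w)]; exact_mod_cast hconn w (f y) y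
    change (G.dist w y : ℝ) < 4 * t
    linarith [hy.2]
  have hS1 := Finset.card_nsmul_le_sum a _ _ hlow
  have hS2 := Finset.sum_le_card_nsmul b _ _ hup
  have hdc' : (∑ y ∈ a, ((Finset.bipartiteAbove (fun y w => w ∈ ball G (f y) t) b y).card : ℝ))
      = ∑ w ∈ b, ((Finset.bipartiteBelow (fun y w => w ∈ ball G (f y) t) a w).card : ℝ) := by
    exact_mod_cast hdc
  rw [hdc'] at hS1
  have hS := hS1.trans hS2
  rw [nsmul_eq_mul, nsmul_eq_mul, Real.mul_rpow (by norm_num) (by linarith)] at hS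
  have htp : 0 < t ^ α := by positivity
  have hS3 : (a.card : ℝ) ≤ C ^ 2 * 4 ^ α * b.card := by
    have h := mul_le_mul_of_nonneg_left hS (show 0 ≤ C / t ^ α by positivity)
    have hC0 : C ≠ 0 := by positivity
    have e1 : C / t ^ α * (a.card * (C⁻¹ * t ^ α)) = a.card := by field_simp
    have e2 : C / t ^ α * (b.card * (C * (4 ^ α * t ^ α))) = C ^ 2 * 4 ^ α * b.card := by
      field_simp
    rwa [e1, e2] at h
  rw [hca, hcb]
  push_cast
  linarith

theorem ann_iter (G : SimpleGraph V) (α C : ℝ) (hC : 1 ≤ C) (hα : 0 < α)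
    (hvol : ∀ (x : V) (r : ℝ), 1 ≤ r →
      C⁻¹ * r ^ α ≤ ((ball G x r).ncard : ℝ) ∧ ((ball G x r).ncard : ℝ) ≤ C * r ^ α)
    (x : V) (r : ℝ) (k : ℕ) (hr : 4 ^ k ≤ r) :
    ((ann G x r (r / 4 ^ k)).ncard : ℝ) ≤
      ((C ^ 2 * 4 ^ α) / (1 + C ^ 2 * 4 ^ α)) ^ k * ((ball G x r).ncard : ℝ) := by
  induction k with
  | zero =>
    have : ann G x r (r / 4 ^ 0) = ball G x r := by
      ext y; simp [ann, ball]
    rw [this]; simp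
  | succ k ih =>
    have h4 : (1 : ℝ) ≤ 4 ^ k := one_le_pow₀ (by norm_num)
    rw [pow_succ] at hr
    have hK : 0 < C ^ 2 * (4 : ℝ) ^ α := by positivity
    have e : 4 * (r / 4 ^ (k + 1)) = r / 4 ^ k := by rw [pow_succ]; field_simp
    have h := ann_step G α C hC hα hvol x r (r / 4 ^ (k + 1))
      (by rw [le_div_iff₀ (by positivity), pow_succ]; linarith)
      (by rw [e]; exact div_le_self (by linarith) h4)
    rw [e] at h
    have ih := ih (by linarith)
    rw [pow_succ (_ / _) k, mul_right_comm, ← mul_div_assoc, le_div_iff₀ (by positivity)]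
    nlinarith

/-- Under (i) volume growth `|B_x(r)| ≍ r^α`, (ii) the exit-time upper bound
`E_y[τ_r(x)] ≤ C r^β` for `y ∈ B_x(r)`, and (iii) the Green function lower bound
`inf_{y ∈ B_x(ur)} g_r(x,y) ≥ c(u) r^{β-α}` for each `u ∈ (0,1)`: for every `ε > 0` there is
`η > 0` such that for all `x`, all large `r`, and all `A ⊆ B_x(r)` with `|A| ≥ ε |B_x(r)|`,
the walk started at `x` hits `A` before exiting `B_x(r)` with probability at least `η`. -/
theorem hit_dense_set_prob {V : Type*} (G : SimpleGraph V) [G.LocallyFinite]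
    (α β C : ℝ) (hC : 1 ≤ C) (hα : 0 < α) (hβ : 0 < β)
    (hvol : ∀ (x : V) (r : ℝ), 1 ≤ r →
      C⁻¹ * r ^ α ≤ ((ball G x r).ncard : ℝ) ∧ ((ball G x r).ncard : ℝ) ≤ C * r ^ α)
    (hexit : ∀ (x y : V) (r : ℝ), 1 ≤ r → y ∈ ball G x r →
      expectedExitTime G (ball G x r) y ≤ C * r ^ β)
    (hgreen : ∀ u : ℝ, 0 < u → u < 1 → ∃ c : ℝ, 0 < c ∧ ∀ (x : V) (r : ℝ), 1 ≤ r →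
      ∀ y ∈ ball G x (u * r), c * r ^ (β - α) ≤ green G (ball G x r) x y) :
    ∀ ε : ℝ, 0 < ε → ∃ η : ℝ, 0 < η ∧ ∃ r₀ : ℝ, ∀ (x : V) (r : ℝ), r₀ ≤ r →
      ∀ A : Set V, A ⊆ ball G x r → ε * ((ball G x r).ncard : ℝ) ≤ (A.ncard : ℝ) →
      η ≤ hitSetProb G (ball G x r) A x := by
  intro ε hε
  have hG := preconn G α C hC hα hvol
  have hbf := ball_finite G α C hC hvol
  have hK : 0 < C ^ 2 * (4 : ℝ) ^ α := by positivity
  obtain ⟨k₀, hk₀⟩ := exists_pow_lt_of_lt_one (half_pos hε)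
    (show (C ^ 2 * 4 ^ α) / (1 + C ^ 2 * 4 ^ α) < 1 by
      rw [div_lt_one (by positivity)]; linarith)
  set θ := (C ^ 2 * 4 ^ α) / (1 + C ^ 2 * 4 ^ α) with hθ
  have hθ0 : 0 ≤ θ := by positivity
  have hθ1 : θ ≤ 1 := by rw [hθ, div_le_one (by positivity)]; linarith
  set k := k₀ + 1 with hk
  have hkθ : θ ^ k ≤ ε / 2 := (pow_le_pow_of_le_one hθ0 hθ1 (by omega)).trans hk₀.le
  have h4k : (1 : ℝ) < 4 ^ k := one_lt_pow₀ (by norm_num) (by omega)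
  have hinv : ((4 : ℝ) ^ k)⁻¹ < 1 := inv_lt_one_of_one_lt₀ h4k
  have hinv0 : 0 < ((4 : ℝ) ^ k)⁻¹ := by positivity
  obtain ⟨c, hc, hcg⟩ := hgreen (1 - (4 ^ k)⁻¹) (by linarith) (by linarith)
  refine ⟨ε * c / (2 * C ^ 2), by positivity, 4 ^ k, ?_⟩
  intro x r hr A hA hAc
  have hr1 : 1 ≤ r := by linarith
  have hr0 : 0 < r := by linarith
  set B := ball G x r with hB
  -- summability of all Green functions from `x`
  have hgs : ∀ y ∈ B, Summable fun n => recS G B ∅ {y} n x := by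
    intro y hy
    have hy' : (G.dist x y : ℝ) < r := hy
    obtain ⟨s, hs1, hs2⟩ := exists_between (max_lt ((div_lt_one hr0).2 hy') zero_lt_one)
    obtain ⟨c', hc', h'⟩ := hgreen s ((le_max_right _ _).trans_lt hs1) hs2
    have h'' := h' x r hr1 y (by
      have := (le_max_left _ _).trans_lt hs1
      rw [div_lt_iff₀ hr0] at this
      exact this)
    rw [green_eq] at h''
    by_contra hns
    rw [tsum_eq_zero_of_not_summable hns] at h''
    have : 0 < c' * r ^ (β - α) := by positivity
    linarith
  have hfx : Summable fun n => recS G B ∅ Set.univ n x := by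
    have h1 : Summable fun n => ∑ y ∈ (hbf x r).toFinset, recS G B ∅ {y} n x :=
      summable_sum fun y hy => hgs y (by simpa [hB] using hy)
    refine h1.congr fun n => ?_
    rw [sum_recS, recS_univ]
    simp [hB]
  have hfz : ∀ z ∈ B, Summable fun n => recS G B ∅ Set.univ n z := fun z hz =>
    summable_ball G hG x r hfx _ z hz rfl
  have hAf : A.Finite := (hbf x r).subset hA
  set A' := A ∩ ball G x ((1 - (4 ^ k)⁻¹) * r) with hA'
  have hA'f : A'.Finite := hAf.subset Set.inter_subset_left
  have hkey := key_ineq G B A A' hA Set.inter_subset_left (C * r ^ β) (by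
    intro z hz N
    refine le_trans ?_ (hexit x z r hr1 (hA hz))
    rw [exit_eq]
    refine le_trans (Finset.sum_le_sum fun n _ => recS_le ..) ?_
    exact (hfz z (hA hz)).sum_le_tsum _ fun n _ => recS_nonneg ..)
  have hhs : Summable fun n => recS G B A A n x :=
    Summable.of_nonneg_of_le (fun n => recS_nonneg ..) (fun n => recS_le ..) hfx
  have hCr : 0 ≤ C * r ^ β := by positivity
  have hmain : ∑ y ∈ hA'f.toFinset, green G B x y ≤ C * r ^ β * hitSetProb G B A x := by
    simp only [green_eq, hitSetProb_eq]
    rw [← Summable.tsum_finsetSum (fun y hy => hgs y (hA ((hA'f.mem_toFinset.1 hy).1)))]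
    refine Real.tsum_le_of_sum_range_le
      (fun n => Finset.sum_nonneg fun y _ => recS_nonneg ..) fun N => ?_
    have e : ∀ n, ∑ y ∈ hA'f.toFinset, recS G B ∅ {y} n x = recS G B ∅ A' n x := by
      intro n; rw [sum_recS]; simp
    simp only [e]
    refine (hkey N x).trans (mul_le_mul_of_nonneg_left ?_ hCr)
    exact hhs.sum_le_tsum _ fun n _ => recS_nonneg ..
  have hlow : (A'.ncard : ℝ) * (c * r ^ (β - α)) ≤ ∑ y ∈ hA'f.toFinset, green G B x y := by
    rw [Set.ncard_eq_toFinset_card _ hA'f, ← nsmul_eq_mul]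
    exact Finset.card_nsmul_le_sum _ _ _ fun y hy =>
      hcg x r hr1 y ((hA'f.mem_toFinset.1 hy).2)
  have hcard : ε / 2 * (B.ncard : ℝ) ≤ A'.ncard := by
    have h1 := ann_iter G α C hC hα hvol x r k hr
    have hannf : (ann G x r (r / 4 ^ k)).Finite := (hbf x r).subset fun y hy => hy.2
    have h2 : A.ncard ≤ A'.ncard + (ann G x r (r / 4 ^ k)).ncard := by
      refine (Set.ncard_le_ncard ?_ (hA'f.union hannf)).trans (Set.ncard_union_le _ _)
      intro y hy
      have hyB : (G.dist x y : ℝ) < r := hA hy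
      by_cases hyr : (G.dist x y : ℝ) < (1 - (4 ^ k)⁻¹) * r
      · exact Or.inl ⟨hy, hyr⟩
      · right
        refine ⟨?_, hyB⟩
        rw [div_eq_mul_inv]
        linarith
    have h2' : (A.ncard : ℝ) ≤ A'.ncard + (ann G x r (r / 4 ^ k)).ncard := by exact_mod_cast h2
    have h3 : θ ^ k * (B.ncard : ℝ) ≤ ε / 2 * B.ncard :=
      mul_le_mul_of_nonneg_right hkθ (by positivity)
    linarith
  have hBv := (hvol x r hr1).1
  have hfinal : ε / 2 * (C⁻¹ * r ^ α) * (c * r ^ (β - α)) ≤ C * r ^ β * hitSetProb G B A x := by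
    refine le_trans (mul_le_mul_of_nonneg_right ?_ (by positivity)) (hlow.trans hmain)
    exact (mul_le_mul_of_nonneg_left hBv (by positivity)).trans hcard
  have hrr : r ^ α * r ^ (β - α) = r ^ β := by
    rw [← Real.rpow_add hr0]; congr 1; ring
  have hrb : 0 < r ^ β := by positivity
  have e : ε / 2 * (C⁻¹ * r ^ α) * (c * r ^ (β - α)) = C * r ^ β * (ε * c / (2 * C ^ 2)) := by
    have hC0 : C ≠ 0 := by positivity
    rw [← hrr]
    field_simp
  rw [e] at hfinal
  exact le_of_mul_le_mul_left hfinal (by positivity)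


end IDLA
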